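/- arXiv:2602.23797 — 2 statements merged into one kernel-verified Lean document; each statement's English description precedes it below -/
import Mathlib

section
/- If (s*, q*, a*) is an equilibrium of the reduced smoking model with s* > 0 and s*(μσ − γα) + μ(γ + μ) ≠ 0, then s* satisfies the quadratic equation Â(s*)² + B̂ s* + Ĉ = 0, where Â = β(γα − σμ), B̂ = μ(βσ + γα) − μ²(σ + β) − μβp(α + σ) − βγ(μ + α), and Ĉ = μ(γ + μ)(μ + αp)(R − 1) with R = β(1−p)/(μ + αp). -/
/-- The smoker fraction `s* > 0` of an endemic equilibrium of the reduced smoking model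
(with nonvanishing denominator) satisfies the quadratic equation
`Â (s*)² + B̂ s* + Ĉ = 0` with
`Â = β(γα − σμ)`,
`B̂ = μ(βσ + γα) − μ²(σ + β) − μβp(α + σ) − βγ(μ + α)`, and
`Ĉ = μ(γ + μ)(μ + αp)(R − 1)`, where `R = β(1−p)/(μ + αp)`. -/
theorem smoking_endemic_quadratic
    (β α σ γ μ p : ℝ)
    (hβ : 0 < β) (hα : 0 < α) (hσ : 0 < σ) (hγ : 0 < γ) (hμ : 0 < μ)
    (hp0 : 0 < p) (hp1 : p < 1)
    (F : ℝ → ℝ → ℝ → ℝ × ℝ × ℝ)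
    (hF : ∀ s q a, F s q a =
      (β * s * (1 - s - q - a) - α * s * a + σ * q * s - μ * s,
       α * s * a - σ * q * s - (γ + μ) * q,
       μ * p + γ * q - μ * a))
    (s q a : ℝ) (heq : F s q a = (0, 0, 0)) (hs : 0 < s)
    (hden : s * (μ * σ - γ * α) + μ * (γ + μ) ≠ 0) :
    (β * (γ * α - σ * μ)) * s ^ 2
      + (μ * (β * σ + γ * α) - μ ^ 2 * (σ + β) - μ * β * p * (α + σ)
          - β * γ * (μ + α)) * s
      + μ * (γ + μ) * (μ + α * p) * (β * (1 - p) / (μ + α * p) - 1) = 0 := by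
  rw [hF] at heq
  simp only [Prod.mk.injEq] at heq
  obtain ⟨h1, h2, h3⟩ := heq
  have hd : μ + α * p ≠ 0 := by positivity
  have e1 : β * (1 - s - q - a) - α * a + σ * q - μ = 0 := by
    have : s * (β * (1 - s - q - a) - α * a + σ * q - μ) = 0 := by linear_combination h1
    exact (mul_eq_zero.mp this).resolve_left hs.ne'
  have hD : q * (s * (μ * σ - γ * α) + μ * (γ + μ)) - α * μ * p * s = 0 := by
    linear_combination (-μ) * h2 - α * s * h3
  have hE : μ * β * (1 - s) - μ ^ 2 - μ * (β - σ) * q - (β + α) * (μ * p + γ * q) = 0 := by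
    linear_combination μ * e1 - (β + α) * h3
  have hC : μ * (γ + μ) * (μ + α * p) * (β * (1 - p) / (μ + α * p) - 1)
      = μ * (γ + μ) * (β * (1 - p) - (μ + α * p)) := by
    field_simp
  rw [hC]
  refine (mul_eq_zero.mp ?_).resolve_left hμ.ne'
  linear_combination (s * (μ * σ - γ * α) + μ * (γ + μ)) * hE
    + (μ * (β - σ) + γ * (β + α)) * hD
end

section
/- If (s*, q*, a*) is an equilibrium of the reduced smoking model with s* > 0 and q* ≥ 0, then q* > 0 and a* > p. In particular, at any endemic equilibrium with nonnegative quitter fraction, the aware fraction strictly exceeds the externally recruited awareness level p. -/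
/-- At any equilibrium of the reduced smoking model with `s* > 0` and `q* ≥ 0`,
one in fact has `q* > 0` and `a* > p`: the aware fraction strictly exceeds the
externally recruited awareness level `p`. -/
theorem endemic_awareness_exceeds_p
    (β α σ γ μ p : ℝ)
    (hβ : 0 < β) (hα : 0 < α) (hσ : 0 < σ) (hγ : 0 < γ) (hμ : 0 < μ)
    (hp0 : 0 < p) (hp1 : p < 1)
    (F : ℝ → ℝ → ℝ → ℝ × ℝ × ℝ)
    (hF : ∀ s q a, F s q a =
      (β * s * (1 - s - q - a) - α * s * a + σ * q * s - μ * s,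
       α * s * a - σ * q * s - (γ + μ) * q,
       μ * p + γ * q - μ * a))
    (s q a : ℝ) (heq : F s q a = (0, 0, 0)) (hs : 0 < s) (hq : 0 ≤ q) :
    0 < q ∧ p < a := by
  rw [hF] at heq
  simp only [Prod.mk.injEq] at heq
  obtain ⟨-, h2, h3⟩ := heq
  have hgq : 0 ≤ γ * q := mul_nonneg hγ.le hq
  have ha : 0 < a := by
    have h : 0 < μ * a := by
      have := mul_pos hμ hp0
      linarith
    exact pos_of_mul_pos_right h hμ.le
  have hq' : 0 < q := by
    rcases hq.lt_or_eq with h | h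
    · exact h
    · exfalso
      rw [← h] at h2
      have := mul_pos (mul_pos hα hs) ha
      linarith
  refine ⟨hq', ?_⟩
  have h4 := mul_pos hγ hq'
  have h5 : μ * p < μ * a := by linarith
  exact lt_of_mul_lt_mul_left h5 hμ.le
end
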